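/- arXiv:math/9412210 — 2 statements merged into one kernel-verified Lean document; each statement's English description precedes it below -/
import Mathlib

section
/- Let (R, m) be a d-dimensional Cohen–Macaulay local ring with d ≥ 1 which is not a regular local ring, let J be generated by a system of parameters z_1, ..., z_d, and set I = J : m. Let s = dim_{R/m}(I/J) (this is the Cohen–Macaulay type of R, since I/J is the socle of R/J). Then I/J ≅ (R/m)^s as R-modules and the minimal number of generators of I is d + s; that is, dim_{R/m}(I/mI) = d + s. -/
open RingTheory.Sequence IsLocalRing

/-- The length of a module: the Krull dimension of its lattice of submodules. -/
noncomputable def moduleLength (R M : Type*) [CommRing R] [AddCommGroup M] [Module R M] :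
    WithBot ℕ∞ :=
  Order.krullDim (Submodule R M)

section

variable {R : Type*} [CommRing R] [IsLocalRing R] [IsNoetherianRing R] {zs : List R}

theorem mem_ofList_eraseIdx_of_mul_get_mem (hzm : ∀ z ∈ zs, z ∈ maximalIdeal R)
    (hreg : IsRegular R zs) (j : Fin zs.length) {r : R}
    (h : r * zs.get j ∈ Ideal.ofList (zs.eraseIdx j)) :
    r ∈ Ideal.ofList (zs.eraseIdx j) := by
  have hperm : zs.Perm (zs.eraseIdx j ++ [zs.get j]) :=
    (List.getElem_cons_eraseIdx_perm j.2).symm.trans (List.perm_append_singleton _ _).symm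
  have hw := hreg.toIsWeaklyRegular.of_perm_of_subset_jacobson_annihilator hperm fun z hz =>
    IsLocalRing.maximalIdeal_le_jacobson _ (hzm z hz)
  rw [isWeaklyRegular_append_iff, isWeaklyRegular_singleton_iff] at hw
  have := mem_of_isSMulRegular_quotient_of_smul_mem hw.2 (x := r)
    (by simpa [mul_comm] using h)
  simpa using this

omit [IsLocalRing R] [IsNoetherianRing R] in
theorem sum_mul_get_sub_mem_ofList_eraseIdx (c : Fin zs.length → R) (j : Fin zs.length) :
    ∑ i, c i * zs.get i - c j * zs.get j ∈ Ideal.ofList (zs.eraseIdx j) := by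
  rw [← Finset.add_sum_erase _ _ (Finset.mem_univ j), add_sub_cancel_left]
  refine Ideal.sum_mem _ fun i hi => Ideal.mul_mem_left _ _ (Ideal.subset_span ?_)
  exact List.mem_eraseIdx_iff_getElem.2
    ⟨i, i.2, fun h => Finset.ne_of_mem_erase hi (Fin.ext h), rfl⟩

omit [IsLocalRing R] [IsNoetherianRing R] in
theorem mem_ofList_iff_exists_sum_mul_get {x : R} :
    x ∈ Ideal.ofList zs ↔ ∃ c : Fin zs.length → R, ∑ i, c i * zs.get i = x := by
  rw [← Ideal.mem_span_range_iff_exists_fun, Set.range_list_get]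

/-- If `a * x` is part of a minimal generating set of the parameter ideal `J` with `a` in the
maximal ideal and `x` in `J : m`, then `m` is generated by `a` and the other parameters. -/
theorem ofList_cons_eraseIdx_eq_maximalIdeal (hzm : ∀ z ∈ zs, z ∈ maximalIdeal R)
    (hreg : IsRegular R zs) {a x : R} (ha : a ∈ maximalIdeal R)
    (hx : x ∈ (Ideal.ofList zs).colon (maximalIdeal R))
    {c : Fin zs.length → R} (hc : ∑ i, c i * zs.get i = a * x) {j : Fin zs.length}
    (hj : c j ∉ maximalIdeal R) :
    Ideal.ofList (a :: zs.eraseIdx j) = maximalIdeal R := by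
  obtain ⟨v, hv⟩ := (IsLocalRing.notMem_maximalIdeal.1 hj).exists_left_inv
  have hax := sum_mul_get_sub_mem_ofList_eraseIdx c j
  rw [hc] at hax
  apply le_antisymm
  · refine Ideal.span_le.2 fun y hy => ?_
    rcases List.mem_cons.1 hy with rfl | hy
    · exact ha
    · exact hzm y (List.mem_of_mem_eraseIdx hy)
  · intro b hb
    obtain ⟨e, he⟩ := mem_ofList_iff_exists_sum_mul_get.1 (Submodule.mem_colon.1 hx b hb)
    have hbx := sum_mul_get_sub_mem_ofList_eraseIdx e j
    rw [he, smul_eq_mul] at hbx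
    have hmem : b - e j * v * a ∈ Ideal.ofList (zs.eraseIdx j) := by
      set K := Ideal.ofList (zs.eraseIdx j)
      set z := zs.get j
      set r := b - e j * v * a with hr
      have hrx : r * x ∈ K := by
        have := K.sub_mem hbx (K.mul_mem_left (e j * v) hax)
        convert! this using 1
        linear_combination -e j * z * hv
      refine mem_ofList_eraseIdx_of_mul_get_mem hzm hreg j ?_
      have := K.mul_mem_left v (K.sub_mem (K.mul_mem_left a hrx) (K.mul_mem_left r hax))
      convert! this using 1
      linear_combination -r * z * hv
    rw [Ideal.ofList_cons]
    rw [← sub_add_cancel b (e j * v * a)]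
    exact add_mem (Ideal.mem_sup_right hmem)
      (Ideal.mem_sup_left (Ideal.mul_mem_left _ _ (Ideal.mem_span_singleton_self a)))

theorem mem_maximalIdeal_of_sum_mul_get_eq_zero (hzm : ∀ z ∈ zs, z ∈ maximalIdeal R)
    (hreg : IsRegular R zs) {c : Fin zs.length → R} (hc : ∑ i, c i * zs.get i = 0)
    (j : Fin zs.length) : c j ∈ maximalIdeal R := by
  have h := sum_mul_get_sub_mem_ofList_eraseIdx c j
  rw [hc, zero_sub, neg_mem_iff] at h
  refine Ideal.span_le.2 (fun y hy => ?_) (mem_ofList_eraseIdx_of_mul_get_mem hzm hreg j h)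
  exact hzm y (List.mem_of_mem_eraseIdx hy)

theorem exists_finset_card_eq_span_eq_maximalIdeal {l : List R}
    (hdim : ringKrullDim R = l.length) (hl : Ideal.ofList l = maximalIdeal R) :
    ∃ t : Finset R, t.card = l.length ∧ Ideal.span (t : Set R) = maximalIdeal R := by
  classical
  have hspan : Ideal.span (l.toFinset : Set R) = maximalIdeal R := by
    rw [← hl, List.coe_toFinset]
  refine ⟨l.toFinset, (List.toFinset_card_le l).antisymm ?_, hspan⟩
  have h := Ideal.height_le_card_of_mem_minimalPrimes_span_finset (p := maximalIdeal R)
    (s := l.toFinset) (by rw [hspan, Ideal.minimalPrimes_eq_subsingleton_self]; rfl)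
  have h' := IsLocalRing.maximalIdeal_height_eq_ringKrullDim (R := R)
  rw [hdim] at h'
  have h'' : (maximalIdeal R).height = (l.length : ℕ∞) := by exact_mod_cast h'
  rw [h''] at h
  exact_mod_cast h

/-- Over a nonregular Cohen–Macaulay local ring, `m (J : m) ⊆ m J` for a parameter ideal `J`,
and the parameters are independent modulo `m J`. -/
theorem sum_mul_get_mem_maximalIdeal_mul_colon_iff (hdim : ringKrullDim R = zs.length)
    (hnotreg : ¬ ∃ t : Finset R, t.card = zs.length ∧ Ideal.span (t : Set R) = maximalIdeal R)
    (hzm : ∀ z ∈ zs, z ∈ maximalIdeal R) (hreg : IsRegular R zs) (c : Fin zs.length → R) :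
    ∑ i, c i * zs.get i ∈ maximalIdeal R * (Ideal.ofList zs).colon (maximalIdeal R) ↔
      ∀ i, c i ∈ maximalIdeal R := by
  constructor
  · intro h i
    have key : ∀ y ∈ maximalIdeal R * (Ideal.ofList zs).colon (maximalIdeal R),
        ∃ e : Fin zs.length → R, ∑ i, e i * zs.get i = y ∧ ∀ i, e i ∈ maximalIdeal R := by
      intro y hy
      induction hy using Submodule.mul_induction_on' with
      | mem_mul_mem a ha x hx =>
        obtain ⟨e, he⟩ := mem_ofList_iff_exists_sum_mul_get.1 (Submodule.mem_colon.1 hx a ha)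
        rw [smul_eq_mul, mul_comm] at he
        refine ⟨e, he, fun j => by_contra fun hj => hnotreg ?_⟩
        have hlen : (a :: zs.eraseIdx j).length = zs.length := by
          rw [List.length_cons, List.length_eraseIdx_add_one j.2]
        rw [← hlen] at hdim ⊢
        exact exists_finset_card_eq_span_eq_maximalIdeal hdim
          (ofList_cons_eraseIdx_eq_maximalIdeal hzm hreg ha hx he hj)
      | add x _ y _ hx hy =>
        obtain ⟨e, rfl, he⟩ := hx
        obtain ⟨f, rfl, hf⟩ := hy
        exact ⟨e + f, by simp [add_mul, Finset.sum_add_distrib], fun i => add_mem (he i) (hf i)⟩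
    obtain ⟨e, he, hem⟩ := key _ h
    have := mem_maximalIdeal_of_sum_mul_get_eq_zero hzm hreg (c := c - e)
      (by simp only [Pi.sub_apply, sub_mul, Finset.sum_sub_distrib, he, sub_self]) i
    simpa using add_mem this (hem i)
  · refine fun h => Ideal.sum_mem _ fun i _ => Ideal.mul_mem_mul (h i) ?_
    exact Submodule.mem_colon.2 fun s _ =>
      Ideal.mul_mem_right _ _ (Ideal.subset_span (List.get_mem zs i))

omit [IsNoetherianRing R] in
theorem length_fin_fun_residue (n : ℕ) :
    Module.length R (Fin n → R ⧸ maximalIdeal R) = n := by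
  have : IsSimpleModule R (R ⧸ maximalIdeal R) :=
    isSimpleModule_iff_quot_maximal.2 ⟨_, inferInstance, ⟨.refl _ _⟩⟩
  simp

omit [IsNoetherianRing R] in
theorem nonempty_linearEquiv_fin_fun_residue {M : Type*} [AddCommGroup M] [Module R M]
    [Module.Finite R M] (hM : Module.IsTorsionBySet R M (maximalIdeal R)) {s : ℕ}
    (hs : Module.length R M = s) : Nonempty (M ≃ₗ[R] (Fin s → R ⧸ maximalIdeal R)) := by
  let _ : Module (R ⧸ maximalIdeal R) M := hM.module
  have : IsScalarTower R (R ⧸ maximalIdeal R) M := hM.isScalarTower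
  let _ : Field (R ⧸ maximalIdeal R) := Ideal.Quotient.field _
  have : Module.Finite (R ⧸ maximalIdeal R) M := Module.Finite.of_restrictScalars_finite R _ M
  let e := (Module.finBasis (R ⧸ maximalIdeal R) M).equivFun.restrictScalars R
  have h := e.length_eq
  rw [length_fin_fun_residue, hs, Nat.cast_inj] at h
  rw [h]
  exact ⟨e⟩

end

/-- Let `(R, m)` be a `d`-dimensional Cohen–Macaulay local ring, `d ≥ 1`,
which is not regular, `J` generated by a system of parameters `z₁, …, z_d`, and
`I = J : m`.  Let `s = dim_{R/m}(I/J)` (the Cohen–Macaulay type of `R`; since `m·(I/J) = 0`,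
this vector-space dimension is the length of `I/J`).  Then `I/J ≅ (R/m)^s` and the minimal
number of generators of `I` is `d + s`, i.e. `dim_{R/m}(I/mI) = d + s`. -/
theorem links_of_primes_stmt9 {R : Type*} [CommRing R] [IsLocalRing R] [IsNoetherianRing R]
    (d : ℕ) (hd : 1 ≤ d) (hdim : ringKrullDim R = d)
    (hnotreg : ¬ ∃ t : Finset R, t.card = d ∧ Ideal.span (t : Set R) = maximalIdeal R)
    (zs : List R) (hlen : zs.length = d)
    (hzm : ∀ z ∈ zs, z ∈ maximalIdeal R)
    (hreg : IsRegular R zs)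
    (J I : Ideal R) (hJ : J = Ideal.ofList zs)
    (hI : I = J.colon (maximalIdeal R))
    (s : ℕ)
    (hs : moduleLength R (↥I ⧸ (Submodule.comap I.subtype (J : Submodule R R))) = s) :
    Nonempty ((↥I ⧸ (Submodule.comap I.subtype (J : Submodule R R))) ≃ₗ[R]
        (Fin s → R ⧸ maximalIdeal R)) ∧
      moduleLength R (↥I ⧸ (Submodule.comap I.subtype (maximalIdeal R * I))) =
        ((d + s : ℕ) : WithBot ℕ∞) := by
  subst hlen hJ
  have hlength : ∀ M : Type _, ∀ [AddCommGroup M] [Module R M],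
      moduleLength R M = Module.length R M := fun M _ _ => (Module.coe_length R M).symm
  have hJI : Ideal.ofList zs ≤ I := by
    rw [hI]
    exact fun x hx => Submodule.mem_colon.2 fun _ _ => Ideal.mul_mem_right _ _ hx
  set N : Submodule R I := Submodule.comap I.subtype (Ideal.ofList zs : Submodule R R) with hN
  set Q : Submodule R I := Submodule.comap I.subtype (maximalIdeal R * I) with hQ
  rw [hlength] at hs ⊢
  have hs' : Module.length R (I ⧸ N) = s := by exact_mod_cast hs
  have hmI : maximalIdeal R * I ≤ Ideal.ofList zs := by
    rw [Ideal.mul_le, hI]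
    intro a ha x hx
    rw [mul_comm]
    exact Submodule.mem_colon.1 hx a ha
  have hQN : Q ≤ N := Submodule.comap_mono hmI
  refine ⟨nonempty_linearEquiv_fin_fun_residue ?_ hs', ?_⟩
  · rintro x ⟨a, ha⟩
    obtain ⟨x, rfl⟩ := N.mkQ_surjective x
    refine (Submodule.Quotient.mk_eq_zero N).2 ?_
    exact hmI (Ideal.mul_mem_mul ha x.2)
  · let z : Fin zs.length → I := fun i => ⟨zs.get i, hJI (Ideal.subset_span (List.get_mem zs i))⟩
    let f := Fintype.linearCombination R z
    have hf : ∀ c, (f c : R) = ∑ i, c i * zs.get i := fun c => by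
      simp [f, z, Fintype.linearCombination_apply]
    let g := Q.mkQ ∘ₗ f
    let p : (Fin zs.length → R) →ₗ[R] (Fin zs.length → R ⧸ maximalIdeal R) :=
      LinearMap.pi fun i => (maximalIdeal R).mkQ ∘ₗ LinearMap.proj i
    have hp : Function.Surjective p := fun y => by
      choose c hc using fun i => (maximalIdeal R).mkQ_surjective (y i)
      exact ⟨c, funext hc⟩
    have hker : LinearMap.ker g = LinearMap.ker p := by
      ext c
      have hgc : c ∈ LinearMap.ker g ↔ (f c : R) ∈ maximalIdeal R * I :=
        Submodule.Quotient.mk_eq_zero Q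
      rw [hgc, hf, hI,
        sum_mul_get_mem_maximalIdeal_mul_colon_iff hdim hnotreg hzm hreg, LinearMap.mem_ker,
        funext_iff]
      exact forall_congr' fun i => (Submodule.Quotient.mk_eq_zero _).symm
    have e : LinearMap.range g ≃ₗ[R] (Fin zs.length → R ⧸ maximalIdeal R) :=
      g.quotKerEquivRange.symm ≪≫ₗ Submodule.quotEquivOfEq _ _ hker ≪≫ₗ
        p.quotKerEquivOfSurjective hp
    have hex : Function.Exact (LinearMap.range g).subtype (Submodule.factor hQN) := by
      intro y
      obtain ⟨y, rfl⟩ := Q.mkQ_surjective y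
      rw [Submodule.coe_subtype, Subtype.range_coe]
      have hy : Submodule.factor hQN (Q.mkQ y) = 0 ↔ (y : R) ∈ Ideal.ofList zs :=
        Submodule.Quotient.mk_eq_zero N
      rw [hy]
      constructor
      · intro h
        obtain ⟨c, hc⟩ := mem_ofList_iff_exists_sum_mul_get.1 h
        exact ⟨c, congrArg Q.mkQ (Subtype.ext ((hf c).trans hc))⟩
      · rintro ⟨c, hc⟩
        have hyc : (f c : R) - y ∈ maximalIdeal R * I := (Submodule.Quotient.eq Q).1 hc
        have hfc : (f c : R) ∈ Ideal.ofList zs :=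
          mem_ofList_iff_exists_sum_mul_get.2 ⟨c, (hf c).symm⟩
        exact (Submodule.sub_mem_iff_right _ hfc).1 (hmI hyc)
    have hadd := Module.length_eq_add_of_exact (LinearMap.range g).subtype (Submodule.factor hQN)
      (Submodule.subtype_injective _) (Submodule.factor_surjective hQN) hex
    rw [e.length_eq, length_fin_fun_residue, hs'] at hadd
    rw [hadd]
    push_cast
    rfl
end

section
/- Let (R, m) be a d-dimensional Cohen–Macaulay local ring of Cohen–Macaulay type s ≥ 2, let J be generated by a regular sequence of length d contained in m (a system of parameters), and set I = J : m, so that s = dim_{R/m}(I/J). Let δ(I) denote the kernel of the natural surjection from the second symmetric power S_2(I) onto I². Then the length of δ(I) is λ(δ(I)) = s(s+1)/2 = binomial(s+1, 2). -/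
open RingTheory.Sequence IsLocalRing TensorProduct

/-- The submodule of relations defining the second symmetric power of `M`. -/
def sym2Relations (R M : Type*) [CommRing R] [AddCommGroup M] [Module R M] :
    Submodule R (M ⊗[R] M) :=
  Submodule.span R {z | ∃ x y : M, z = x ⊗ₜ[R] y - y ⊗ₜ[R] x}

/-- The second symmetric power `S₂(M)` of an `R`-module `M`. -/
def Sym2Mod (R M : Type*) [CommRing R] [AddCommGroup M] [Module R M] :=
  (M ⊗[R] M) ⧸ sym2Relations R M

noncomputable instance (R M : Type*) [CommRing R] [AddCommGroup M] [Module R M] :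
    AddCommGroup (Sym2Mod R M) :=
  inferInstanceAs (AddCommGroup ((M ⊗[R] M) ⧸ sym2Relations R M))

noncomputable instance (R M : Type*) [CommRing R] [AddCommGroup M] [Module R M] :
    Module R (Sym2Mod R M) :=
  inferInstanceAs (Module R ((M ⊗[R] M) ⧸ sym2Relations R M))

/-- The natural map `S₂(I) → R` induced by multiplication `x·y ↦ xy`; its image is `I²`,
and its kernel coincides with the kernel `δ(I)` of the natural surjection `S₂(I) → I²`. -/
noncomputable def sym2MulMap {R : Type*} [CommRing R] (I : Ideal R) :
    Sym2Mod R ↥I →ₗ[R] R :=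
  Submodule.liftQ (sym2Relations R ↥I)
    (TensorProduct.lift ((LinearMap.mul R R).compl₁₂ I.subtype I.subtype))
    (by
      rw [sym2Relations, Submodule.span_le]
      rintro z ⟨x, y, rfl⟩
      simp [LinearMap.mem_ker, mul_comm])

/-- The bilinear product map `M × M → S₂(M)`. -/
noncomputable def sym2Mul (R M : Type*) [CommRing R] [AddCommGroup M] [Module R M] :
    M →ₗ[R] M →ₗ[R] Sym2Mod R M :=
  (TensorProduct.mk R M M).compr₂ (sym2Relations R M).mkQ

/-- A symmetric bilinear map factors through the second symmetric power. -/
noncomputable def sym2Lift {R M P : Type*} [CommRing R] [AddCommGroup M] [Module R M]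
    [AddCommGroup P] [Module R P] (B : M →ₗ[R] M →ₗ[R] P) (hB : ∀ x y, B x y = B y x) :
    Sym2Mod R M →ₗ[R] P :=
  Submodule.liftQ (sym2Relations R M) (TensorProduct.lift B) (by
    rw [sym2Relations, Submodule.span_le]
    rintro z ⟨x, y, rfl⟩
    simp [LinearMap.mem_ker, hB x y])

section Sym2Mod

variable {R M P : Type*} [CommRing R] [AddCommGroup M] [Module R M]
  [AddCommGroup P] [Module R P]

theorem sym2Lift_mul (B : M →ₗ[R] M →ₗ[R] P) (hB : ∀ x y, B x y = B y x) (x y : M) :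
    sym2Lift B hB (sym2Mul R M x y) = B x y := by
  change Submodule.liftQ _ _ _ (Submodule.Quotient.mk (x ⊗ₜ[R] y)) = _
  rw [Submodule.liftQ_apply, TensorProduct.lift.tmul]

theorem sym2Mul_comm (x y : M) : sym2Mul R M x y = sym2Mul R M y x :=
  (Submodule.Quotient.eq _).2 (Submodule.subset_span ⟨x, y, rfl⟩)

theorem sym2Mod_eq_top_of_sym2Mul_mem (N : Submodule R (Sym2Mod R M))
    (h : ∀ x y, sym2Mul R M x y ∈ N) : N = ⊤ := by
  rw [eq_top_iff]
  rintro u -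
  obtain ⟨t, rfl⟩ := Submodule.Quotient.mk_surjective (sym2Relations R M) u
  induction t using TensorProduct.induction_on with
  | zero => exact N.zero_mem
  | tmul x y => exact h x y
  | add a b ha hb => exact N.add_mem ha hb

theorem sym2MulMap_mul (I : Ideal R) (x y : I) :
    sym2MulMap I (sym2Mul R I x y) = (x : R) * y := by
  change Submodule.liftQ _ _ _ (Submodule.Quotient.mk (x ⊗ₜ[R] y)) = _
  rw [Submodule.liftQ_apply, TensorProduct.lift.tmul]
  rfl

end Sym2Mod

section Coordinates

variable {R M k ι : Type*} [CommRing R] [AddCommGroup M] [Module R M] [Field k] [Algebra R k]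
  [DecidableEq ι]

/-- The coordinate bilinear forms of the symmetric square attached to linear forms `φ i`. -/
noncomputable def sym2CoordForm (φ : ι → M →ₗ[R] k) (p : Sym2 ι) : M →ₗ[R] M →ₗ[R] k :=
  Sym2.lift ⟨fun i j => if i = j then (LinearMap.mul R k).compl₁₂ (φ i) (φ j) else
    (LinearMap.mul R k).compl₁₂ (φ i) (φ j) + (LinearMap.mul R k).compl₁₂ (φ j) (φ i), by
    intro i j
    by_cases h : i = j
    · subst h; rfl
    · simp [h, Ne.symm h, add_comm]⟩ p

theorem sym2CoordForm_mk (φ : ι → M →ₗ[R] k) (i j : ι) (x y : M) :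
    sym2CoordForm φ s(i, j) x y =
      if i = j then φ i x * φ j y else φ i x * φ j y + φ j x * φ i y := by
  simp only [sym2CoordForm, Sym2.lift_mk]
  split_ifs <;> simp

theorem sym2CoordForm_comm (φ : ι → M →ₗ[R] k) (p : Sym2 ι) (x y : M) :
    sym2CoordForm φ p x y = sym2CoordForm φ p y x := by
  induction p with
  | _ i j =>
    simp only [sym2CoordForm_mk]
    split_ifs with h
    · subst h; ring
    · ring

/-- The coordinates on `S₂(M)` induced by linear forms on `M`. -/
noncomputable def sym2Coord (φ : ι → M →ₗ[R] k) : Sym2Mod R M →ₗ[R] (Sym2 ι → k) :=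
  LinearMap.pi fun p => sym2Lift (sym2CoordForm φ p) (sym2CoordForm_comm φ p)

theorem sym2Coord_mul (φ : ι → M →ₗ[R] k) (x y : M) (p : Sym2 ι) :
    sym2Coord φ (sym2Mul R M x y) p = sym2CoordForm φ p x y :=
  sym2Lift_mul (sym2CoordForm φ p) (sym2CoordForm_comm φ p) x y

/-- The product in `S₂(M)` of the members of a family indexed by an unordered pair. -/
noncomputable def sym2Prod (R : Type*) {M ι : Type*} [CommRing R] [AddCommGroup M] [Module R M]
    (e : ι → M) (p : Sym2 ι) : Sym2Mod R M :=
  Sym2.lift ⟨fun i j => sym2Mul R M (e i) (e j), fun _ _ => sym2Mul_comm _ _⟩ p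

theorem sym2Coord_sym2Prod (φ : ι → M →ₗ[R] k) (e : ι → M)
    (he : ∀ i j, φ i (e j) = if i = j then 1 else 0) (p : Sym2 ι) :
    sym2Coord φ (sym2Prod R e p) = Pi.single p 1 := by
  funext q
  induction p with
  | _ i j =>
    induction q with
    | _ a b =>
      simp only [sym2Prod, Sym2.lift_mk, sym2Coord_mul, sym2CoordForm_mk, he, Pi.single_apply,
        Sym2.eq_iff]
      split_ifs <;> grind

variable [Fintype ι]

theorem sym2Coord_surjective (hk : Function.Surjective (algebraMap R k))
    (φ : ι → M →ₗ[R] k) (e : ι → M) (he : ∀ i j, φ i (e j) = if i = j then 1 else 0) :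
    Function.Surjective (sym2Coord φ) := by
  intro f
  choose c hc using fun p => hk (f p)
  refine ⟨∑ p, c p • sym2Prod R e p, ?_⟩
  funext q
  simp [sym2Coord_sym2Prod φ e he, Pi.single_apply, Algebra.smul_def, hc]

theorem ker_sym2Coord (hk : Function.Surjective (algebraMap R k))
    (φ : ι → M →ₗ[R] k) (e : ι → M) (he : ∀ i j, φ i (e j) = if i = j then 1 else 0) :
    LinearMap.ker (sym2Coord φ) =
      Submodule.span R {u | ∃ n x, (∀ i, φ i n = 0) ∧ u = sym2Mul R M n x} := by
  set K := Submodule.span R {u | ∃ n x, (∀ i, φ i n = 0) ∧ u = sym2Mul R M n x} with hKdef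
  have hK : ∀ n x, (∀ i, φ i n = 0) → sym2Mul R M n x ∈ K := fun n x hn =>
    Submodule.subset_span ⟨n, x, hn, rfl⟩
  have hle : K ≤ LinearMap.ker (sym2Coord φ) := by
    rw [hKdef, Submodule.span_le]
    rintro _ ⟨n, x, hn, rfl⟩
    ext p
    induction p with
    | _ i j => simp [sym2Coord_mul, sym2CoordForm_mk, hn]
  have key : K ⊔ Submodule.span R (Set.range (sym2Prod R e)) = ⊤ := by
    refine sym2Mod_eq_top_of_sym2Mul_mem _ fun x y => ?_
    have hdec : ∀ x : M, ∃ c : ι → R, ∃ n, (∀ i, φ i n = 0) ∧ x = n + ∑ i, c i • e i := by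
      intro x
      choose c hc using fun i => hk (φ i x)
      refine ⟨c, x - ∑ i, c i • e i, fun i => ?_, by abel⟩
      simp [he, Algebra.smul_def, hc]
    obtain ⟨c, n, hn, hx⟩ := hdec x
    obtain ⟨b, n', hn', hy⟩ := hdec y
    have h1 : sym2Mul R M x y = (sym2Mul R M n y + sym2Mul R M n' (∑ i, c i • e i)) +
        ∑ i, ∑ j, (b j * c i) • sym2Mul R M (e i) (e j) := by
      rw [sym2Mul_comm n' _, hy]
      conv_lhs => rw [hx]
      simp only [map_add, LinearMap.add_apply, map_sum, map_smul, LinearMap.sum_apply,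
        LinearMap.smul_apply, mul_smul, smul_add, Finset.sum_add_distrib]
      rw [Finset.sum_comm]
      simp only [Finset.smul_sum]
      abel
    rw [h1]
    refine Submodule.add_mem_sup (K.add_mem (hK _ _ hn) (hK _ _ hn')) ?_
    refine Submodule.sum_mem _ fun i _ => Submodule.sum_mem _ fun j _ => Submodule.smul_mem _ _ ?_
    exact Submodule.subset_span ⟨s(i, j), rfl⟩
  refine le_antisymm (fun u hu => ?_) hle
  obtain ⟨v, hv, w, hw, rfl⟩ := Submodule.mem_sup.1 (key ▸ Submodule.mem_top : u ∈ _)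
  obtain ⟨c, rfl⟩ := (Submodule.mem_span_range_iff_exists_fun R).1 hw
  refine K.add_mem hv (Submodule.sum_mem _ fun p _ => ?_)
  have hp := congrFun (LinearMap.mem_ker.1 hu) p
  rw [map_add, LinearMap.mem_ker.1 (hle hv)] at hp
  have hcp : algebraMap R k (c p) = 0 := by
    simpa [sym2Coord_sym2Prod φ e he, Pi.single_apply, Algebra.smul_def] using hp
  induction p with
  | _ i j =>
    have : c s(i, j) • sym2Prod R e s(i, j) = sym2Mul R M (c s(i, j) • e i) (e j) := by
      rw [map_smul]; rfl
    rw [this]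
    exact hK _ _ fun a => by rw [map_smul, Algebra.smul_def, hcp, zero_mul]

end Coordinates

section RegularSequence

variable {R : Type*} [CommRing R]

/-- Elementwise form of weak regularity of `z 0, …, z (d - 1)`: each `z n` is a nonzerodivisor
modulo the ideal generated by its predecessors. -/
def IsRegularFamily (d : ℕ) (z : ℕ → R) : Prop :=
  ∀ n < d, ∀ a : R, (∃ e : ℕ → R, a * z n = ∑ i ∈ Finset.range n, e i * z i) →
    ∃ e : ℕ → R, a = ∑ i ∈ Finset.range n, e i * z i

theorem mem_ofList_take_iff (zs : List R) (n : ℕ) (hn : n ≤ zs.length) (x : R) :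
    x ∈ Ideal.ofList (zs.take n) ↔
      ∃ e : ℕ → R, x = ∑ i ∈ Finset.range n, e i * zs.getD i 0 := by
  induction n generalizing x with
  | zero => simp
  | succ n ih =>
    have hn' : n < zs.length := hn
    rw [List.take_add_one, List.getElem?_eq_getElem hn', Option.toList_some, Ideal.ofList_append,
      Ideal.ofList_singleton, Submodule.mem_sup]
    constructor
    · rintro ⟨y, hy, w, hw, rfl⟩
      obtain ⟨e, rfl⟩ := (ih hn'.le y).1 hy
      obtain ⟨c, rfl⟩ := Ideal.mem_span_singleton'.1 hw
      refine ⟨Function.update e n c, ?_⟩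
      rw [Finset.sum_range_succ, Function.update_self, List.getD_eq_getElem _ _ hn']
      congr 1
      refine Finset.sum_congr rfl fun i hi => ?_
      rw [Function.update_of_ne (Finset.mem_range.1 hi).ne]
    · rintro ⟨e, rfl⟩
      refine ⟨_, (ih hn'.le _).2 ⟨e, rfl⟩, e n * zs[n],
        Ideal.mem_span_singleton'.2 ⟨_, rfl⟩, ?_⟩
      rw [Finset.sum_range_succ, List.getD_eq_getElem _ _ hn']

theorem isRegularFamily_of_isWeaklyRegular (zs : List R) (h : IsWeaklyRegular R zs) :
    IsRegularFamily zs.length fun i => zs.getD i 0 := by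
  intro n hn a ha
  rw [← mem_ofList_take_iff zs n hn.le] at ha ⊢
  have hreg := h.regular_mod_prev n hn
  rw [isSMulRegular_quotient_iff_mem_of_smul_mem] at hreg
  have := hreg a
  simp only [smul_eq_mul, Ideal.mul_top] at this
  apply this
  simpa only [List.getD_eq_getElem _ _ hn, mul_comm] using ha

namespace IsRegularFamily

theorem coeff_mem {d : ℕ} {z : ℕ → R} (hz : IsRegularFamily d z) {J : Ideal R}
    (hJ : ∀ i, z i ∈ J) {n : ℕ} (hn : n ≤ d) (a : ℕ → R)
    (ha : ∑ i ∈ Finset.range n, a i * z i = 0) : ∀ i < n, a i ∈ J := by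
  induction n generalizing a with
  | zero => simp
  | succ n ih =>
    rw [Finset.sum_range_succ] at ha
    obtain ⟨e, he⟩ := hz n hn (a n) ⟨fun i => - a i, by
      simp only [neg_mul, Finset.sum_neg_distrib]
      linear_combination ha⟩
    have han : a n ∈ J := he ▸ J.sum_mem fun i _ => J.mul_mem_left _ (hJ i)
    intro i hi
    rcases Nat.lt_succ_iff_lt_or_eq.1 hi with hi | rfl
    · have := ih (Nat.le_of_succ_le hn) (fun i => a i + e i * z n) (by
        rw [← ha, he, Finset.sum_mul, ← Finset.sum_add_distrib]
        exact Finset.sum_congr rfl fun i _ => by ring) i hi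
      exact (J.add_mem_iff_left (J.mul_mem_left _ (hJ n))).1 this
    · exact han

theorem sum_sym2Mul_eq_zero {d : ℕ} {I : Ideal R} {z : ℕ → I}
    (hz : IsRegularFamily d fun i => (z i : R)) {n : ℕ} (hn : n ≤ d) (a : ℕ → I)
    (ha : ∑ i ∈ Finset.range n, (a i : R) * z i = 0) :
    ∑ i ∈ Finset.range n, sym2Mul R I (a i) (z i) = 0 := by
  induction n generalizing a with
  | zero => simp
  | succ n ih =>
    rw [Finset.sum_range_succ] at ha ⊢
    obtain ⟨e, he⟩ := hz n hn (a n) ⟨fun i => - (a i : R), by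
      simp only [neg_mul, Finset.sum_neg_distrib]
      linear_combination ha⟩
    have han : a n = ∑ i ∈ Finset.range n, e i • z i := by
      ext
      simp [he]
    have := ih (Nat.le_of_succ_le hn) (fun i => a i + e i • z n) (by
      rw [← ha, he, Finset.sum_mul, ← Finset.sum_add_distrib]
      refine Finset.sum_congr rfl fun i _ => ?_
      simp only [Submodule.coe_add, Submodule.coe_smul, smul_eq_mul]
      ring)
    rw [← this, han, map_sum, LinearMap.sum_apply, ← Finset.sum_add_distrib]
    refine Finset.sum_congr rfl fun i _ => ?_
    rw [map_smul, map_add, map_smul, LinearMap.add_apply, LinearMap.smul_apply,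
      LinearMap.smul_apply, sym2Mul_comm (z i)]

variable [IsLocalRing R] {d : ℕ} {z : ℕ → R} {J I : Ideal R}

theorem coeff_mem_maximalIdeal (hz : IsRegularFamily d z) (hzJ : ∀ i, z i ∈ J)
    (hJ : ∀ x ∈ J, ∃ e : ℕ → R, x = ∑ i ∈ Finset.range d, e i * z i)
    (hI : I = J.colon (maximalIdeal R))
    (hcyc : ¬ ∃ x ∈ I, ∀ y ∈ I, ∃ r, y - r * x ∈ J) {x w : R} (hx : x ∈ I)
    (hw : w ∈ maximalIdeal R) (b : ℕ → R) (hb : x * w = ∑ i ∈ Finset.range d, b i * z i) :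
    ∀ j < d, b j ∈ maximalIdeal R := by
  intro j hj
  by_contra hbj
  rw [mem_maximalIdeal, mem_nonunits_iff, not_not] at hbj
  obtain ⟨u, hu⟩ := hbj.exists_left_inv
  refine hcyc ⟨x, hx, fun y hy => ?_⟩
  obtain ⟨b', hb'⟩ := hJ (y * w) (Submodule.mem_colon.1 (hI ▸ hy) w hw)
  refine ⟨b' j * u, ?_⟩
  have := hz.coeff_mem hzJ le_rfl
    (fun i => x * (b' i - b' j * u * b i) - (y - b' j * u * x) * b i) (by
      have h1 : ∀ i, (x * (b' i - b' j * u * b i) - (y - b' j * u * x) * b i) * z i =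
          x * (b' i * z i) - y * (b i * z i) := fun i => by ring
      simp only [h1, Finset.sum_sub_distrib, ← Finset.mul_sum, ← hb, ← hb']
      ring) j hj
  have h2 := J.mul_mem_left (-u) this
  convert h2 using 1
  linear_combination (-(y - b' j * u * x) - x * b' j * u) * hu

theorem mul_eq_sum (hz : IsRegularFamily d z) (hzJ : ∀ i, z i ∈ J)
    (hJ : ∀ x ∈ J, ∃ e : ℕ → R, x = ∑ i ∈ Finset.range d, e i * z i)
    (hI : I = J.colon (maximalIdeal R))
    (hcyc : ¬ ∃ x ∈ I, ∀ y ∈ I, ∃ r, y - r * x ∈ J) {x y : R} (hx : x ∈ I) (hy : y ∈ I) :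
    ∃ a : ℕ → I, x * y = ∑ i ∈ Finset.range d, (a i : R) * z i := by
  have hcol : ∀ t, t ∈ I ↔ ∀ w ∈ maximalIdeal R, t * w ∈ J := fun t => by
    rw [hI, Submodule.mem_colon]; rfl
  have hym : y ∈ maximalIdeal R := by
    by_contra hu
    rw [mem_maximalIdeal, mem_nonunits_iff, not_not] at hu
    obtain ⟨u, hu⟩ := hu.exists_left_inv
    exact hcyc ⟨y, hy, fun t _ => ⟨t * u, by
      rw [mul_assoc, hu, mul_one, sub_self]; exact J.zero_mem⟩⟩
  obtain ⟨a, ha⟩ := hJ _ ((hcol x).1 hx y hym)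
  have haI : ∀ i < d, a i ∈ I := by
    intro i hi
    rw [hcol]
    intro w hw
    obtain ⟨b, hb⟩ := hJ _ ((hcol x).1 hx w hw)
    have hbm := hz.coeff_mem_maximalIdeal hzJ hJ hI hcyc hx hw b hb i hi
    have := hz.coeff_mem hzJ le_rfl (fun i => a i * w - y * b i) (by
      have h1 : ∀ i, (a i * w - y * b i) * z i = w * (a i * z i) - y * (b i * z i) :=
        fun i => by ring
      simp only [h1, Finset.sum_sub_distrib, ← Finset.mul_sum, ← hb, ← ha]
      ring) i hi
    exact (J.sub_mem_iff_left ((hcol y).1 hy _ hbm)).1 this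
  refine ⟨fun i => if h : i < d then ⟨a i, haI i h⟩ else 0, ha.trans ?_⟩
  refine Finset.sum_congr rfl fun i hi => ?_
  simp only [dif_pos (Finset.mem_range.1 hi)]

end IsRegularFamily

end RegularSequence

theorem exists_coordinates_of_length_eq {R V : Type*} [CommRing R] [IsLocalRing R]
    [AddCommGroup V] [Module R V] (hV : Module.IsTorsionBySet R V (maximalIdeal R)) (s : ℕ)
    (hs : Module.length R V = s) :
    ∃ (φ : Fin s → V →ₗ[R] ResidueField R) (e : Fin s → V),
      (∀ i j, φ i (e j) = if i = j then 1 else 0) ∧ ∀ v, (∀ i, φ i v = 0) → v = 0 := by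
  let _ : Module (ResidueField R) V := hV.module
  have : IsScalarTower R (ResidueField R) V := hV.isScalarTower
  rw [Module.length_eq_of_surjective (R := ResidueField R) residue_surjective,
    Module.length_eq_rank] at hs
  have hrank : Module.rank (ResidueField R) V = s := by
    simpa using hs
  have : Module.Finite (ResidueField R) V :=
    Module.rank_lt_aleph0_iff.1 (hrank ▸ Cardinal.natCast_lt_aleph0)
  let b := Module.finBasisOfFinrankEq (ResidueField R) V (Module.finrank_eq_of_rank_eq hrank)
  refine ⟨fun i => (b.coord i).restrictScalars R, b, fun i j => ?_, fun v hv => ?_⟩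
  · simp [Finsupp.single_apply, eq_comm]
  · exact b.ext_elem fun i => by simpa using hv i

theorem length_pi_residueField {R ι : Type*} [CommRing R] [IsLocalRing R] [Fintype ι] :
    Module.length R (ι → ResidueField R) = Fintype.card ι := by
  rw [Module.length_eq_of_surjective (R := ResidueField R) residue_surjective,
    Module.length_eq_finrank, Module.finrank_fintype_fun_eq_card]

/-- Let `(R, m)` be a `d`-dimensional Cohen–Macaulay local ring of
Cohen–Macaulay type `s ≥ 2`, `J` generated by a system of parameters, `I = J : m`, so that
`s = dim_{R/m}(I/J)` (equal to the length of `I/J`, since `m·(I/J) = 0`).  Let `δ(I)` be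
the kernel of the natural surjection `S₂(I) → I²`.  Then `λ(δ(I)) = s(s+1)/2 = C(s+1, 2)`. -/
theorem links_of_primes_stmt10 {R : Type*} [CommRing R] [IsLocalRing R] [IsNoetherianRing R]
    (d : ℕ) (hdim : ringKrullDim R = d)
    (zs : List R) (hlen : zs.length = d)
    (hzm : ∀ z ∈ zs, z ∈ maximalIdeal R)
    (hreg : IsRegular R zs)
    (J I : Ideal R) (hJ : J = Ideal.ofList zs)
    (hI : I = J.colon (maximalIdeal R))
    (s : ℕ) (hs2 : 2 ≤ s)
    (hs : moduleLength R (↥I ⧸ (Submodule.comap I.subtype (J : Submodule R R))) = s) :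
    moduleLength R ↥(LinearMap.ker (sym2MulMap I)) = ((s + 1).choose 2 : ℕ) := by
  have hJI : J ≤ I := hI ▸ Ideal.le_colon
  set z : ℕ → R := fun i => zs.getD i 0 with hzdef
  have hz : IsRegularFamily d z := hlen ▸ isRegularFamily_of_isWeaklyRegular zs hreg.1
  have hJmem : ∀ x, x ∈ J ↔ ∃ e : ℕ → R, x = ∑ i ∈ Finset.range d, e i * z i := fun x => by
    rw [hJ, ← mem_ofList_take_iff zs d hlen.ge, ← hlen, List.take_length]
  have hzJ : ∀ i, z i ∈ J := by
    intro i
    rcases lt_or_ge i zs.length with h | h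
    · rw [hJ, hzdef]
      exact Ideal.subset_span (by simp [h])
    · simp [hzdef, h]
  set N : Submodule R I := Submodule.comap I.subtype (J : Submodule R R)
  have htors : Module.IsTorsionBySet R (I ⧸ N) (maximalIdeal R) := by
    rintro v ⟨w, hw⟩
    obtain ⟨x, rfl⟩ := Submodule.Quotient.mk_surjective N v
    refine (Submodule.Quotient.mk_eq_zero N).2 ?_
    have := Submodule.mem_colon.1 (hI.le x.2) w hw
    rwa [smul_eq_mul, mul_comm] at this
  obtain ⟨ψ, f, hψ, hψ0⟩ := exists_coordinates_of_length_eq htors s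
    (WithBot.coe_injective ((Module.coe_length R _).trans hs))
  choose e he using fun i => Submodule.Quotient.mk_surjective N (f i)
  let φ : Fin s → I →ₗ[R] ResidueField R := fun i => ψ i ∘ₗ N.mkQ
  have hφe : ∀ i j, φ i (e j) = if i = j then 1 else 0 := fun i j => by
    simp [φ, he, hψ]
  have hφN : ∀ x : I, (∀ i, φ i x = 0) ↔ (x : R) ∈ J := fun x => by
    constructor
    · exact fun h => (Submodule.Quotient.mk_eq_zero N).1 (hψ0 _ h)
    · intro h i
      have : N.mkQ x = 0 := (Submodule.Quotient.mk_eq_zero N).2 h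
      rw [LinearMap.comp_apply, this, map_zero]
  have hcyc : ¬ ∃ x ∈ I, ∀ y ∈ I, ∃ r, y - r * x ∈ J := by
    rintro ⟨x, hx, h⟩
    have key : ∀ i, ∃ r : ResidueField R, ∀ j, φ j (e i) = r * φ j ⟨x, hx⟩ := by
      intro i
      obtain ⟨r, hr⟩ := h (e i) (e i).2
      refine ⟨algebraMap R _ r, fun j => ?_⟩
      have := (hφN (e i - r • ⟨x, hx⟩)).2 hr j
      rwa [map_sub, map_smul, sub_eq_zero, Algebra.smul_def] at this
    obtain ⟨r, hr⟩ := key ⟨0, by omega⟩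
    obtain ⟨r', hr'⟩ := key ⟨1, by omega⟩
    have h00 := hr ⟨0, by omega⟩
    have h01 := hr ⟨1, by omega⟩
    have h11 := hr' ⟨1, by omega⟩
    simp only [hφe, Fin.mk.injEq, one_ne_zero, if_true, if_false] at h00 h01 h11
    rcases mul_eq_zero.1 h01.symm with h | h <;> simp [h] at h00 h11
  let z' : ℕ → I := fun i => ⟨z i, hJI (hzJ i)⟩
  have hk : Function.Surjective (algebraMap R (ResidueField R)) := residue_surjective
  have hker : ∀ u ∈ LinearMap.ker (sym2Coord φ), ∃ a : ℕ → I,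
      u = ∑ i ∈ Finset.range d, sym2Mul R I (a i) (z' i) := by
    intro u hu
    rw [ker_sym2Coord hk φ e hφe] at hu
    induction hu using Submodule.span_induction with
    | mem u hu =>
      obtain ⟨n, x, hn, rfl⟩ := hu
      obtain ⟨c, hc⟩ := (hJmem n).1 ((hφN n).1 hn)
      refine ⟨fun i => c i • x, ?_⟩
      have : n = ∑ i ∈ Finset.range d, c i • z' i := by
        ext
        simp [hc, z']
      rw [this, map_sum, LinearMap.sum_apply]
      refine Finset.sum_congr rfl fun i _ => ?_
      rw [map_smul, map_smul, LinearMap.smul_apply, LinearMap.smul_apply, sym2Mul_comm]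
    | zero => exact ⟨0, by simp⟩
    | add u v _ _ hu hv =>
      obtain ⟨a, rfl⟩ := hu
      obtain ⟨b, rfl⟩ := hv
      exact ⟨a + b, by simp [Finset.sum_add_distrib]⟩
    | smul r u _ hu =>
      obtain ⟨a, rfl⟩ := hu
      exact ⟨r • a, by simp [Finset.smul_sum]⟩
  have hmemker : ∀ a : ℕ → I,
      ∑ i ∈ Finset.range d, sym2Mul R I (a i) (z' i) ∈ LinearMap.ker (sym2Coord φ) := by
    intro a
    rw [ker_sym2Coord hk φ e hφe]
    refine Submodule.sum_mem _ fun i _ => Submodule.subset_span ⟨z' i, a i, ?_, sym2Mul_comm _ _⟩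
    exact (hφN _).2 (hzJ i)
  have hsup : LinearMap.ker (sym2Coord φ) ⊔ LinearMap.ker (sym2MulMap I) = ⊤ := by
    refine sym2Mod_eq_top_of_sym2Mul_mem _ fun x y => ?_
    obtain ⟨a, ha⟩ := hz.mul_eq_sum hzJ (fun x => (hJmem x).1) hI hcyc x.2 y.2
    refine Submodule.mem_sup.2 ⟨_, hmemker a, _, ?_, add_sub_cancel _ _⟩
    simp [LinearMap.mem_ker, sym2MulMap_mul, ha, z']
  let Ψ := (sym2Coord φ).domRestrict (LinearMap.ker (sym2MulMap I))
  have hΨ : Function.Bijective Ψ := by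
    constructor
    · rw [injective_iff_map_eq_zero]
      rintro ⟨u, hu⟩ h
      obtain ⟨a, rfl⟩ := hker u h
      ext
      refine IsRegularFamily.sum_sym2Mul_eq_zero (z := z') hz le_rfl a ?_
      simpa [LinearMap.mem_ker, sym2MulMap_mul] using hu
    · intro g
      obtain ⟨u, rfl⟩ := sym2Coord_surjective hk φ e hφe g
      obtain ⟨v, hv, w, hw, rfl⟩ := Submodule.mem_sup.1 (hsup ▸ Submodule.mem_top : u ∈ _)
      exact ⟨⟨w, hw⟩, by
        rw [map_add, LinearMap.mem_ker.1 hv, zero_add, LinearMap.domRestrict_apply]⟩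
  rw [moduleLength, ← Module.coe_length, (LinearEquiv.ofBijective Ψ hΨ).length_eq,
    length_pi_residueField, Sym2.card, Fintype.card_fin]
  rfl
end
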